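/- There exist an absolute constant K > 0 and R ∈ ℕ such that for every r ≥ R there is a balanced monotone function g_r: {0,1}^r → {0,1} satisfying: for every τ ∈ [16/√r, 1], NS_{1−τ/√r}(g_r) ≤ 1 − K·τ. -/

import Mathlib

/-- Noise stability `NS_η(f) = 1 - 2 Pr[f(x) ≠ f(y)]` where `x` is uniform and `y` is
`η`-correlated with `x`: here `z` records which coordinates are flipped, each coordinate
being flipped independently with probability `(1 - η)/2`. -/
noncomputable def noiseStability {n : ℕ} (η : ℝ) (f : (Fin n → Bool) → Bool) : ℝ :=
  1 - 2 * ∑ x : Fin n → Bool, ∑ z : Fin n → Bool,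
      ((2 ^ n : ℝ))⁻¹ * (∏ i : Fin n, if z i then (1 - η) / 2 else (1 + η) / 2) *
        (if f x ≠ f (fun i => xor (x i) (z i)) then 1 else 0)

open Finset

section Fourier

/-- The sign `±1` encoding of a bit. -/
def boolSign (b : Bool) : ℝ := if b then -1 else 1

lemma sum_noise_eq_one {n : ℕ} (η : ℝ) :
    ∑ z : Fin n → Bool, (∏ i : Fin n, if z i then (1 - η) / 2 else (1 + η) / 2) = 1 := by
  rw [← Fintype.prod_sum (fun (_ : Fin n) (b : Bool) => if b then (1 - η) / 2 else (1 + η) / 2)]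
  apply Finset.prod_eq_one
  intro i _
  rw [Fintype.sum_bool]
  simp only [if_true, Bool.false_eq_true, if_false]
  ring

/-- The coordinatewise exclusive or with a fixed string, as a permutation of the cube. -/
def xorEquiv {n : ℕ} (x : Fin n → Bool) : (Fin n → Bool) ≃ (Fin n → Bool) where
  toFun z := fun i => xor (x i) (z i)
  invFun z := fun i => xor (x i) (z i)
  left_inv z := by funext i; simp
  right_inv z := by funext i; simp

lemma noiseStability_eq_sum_sign {n : ℕ} (η : ℝ) (f : (Fin n → Bool) → Bool) :
    noiseStability η f = ∑ x : Fin n → Bool, ∑ y : Fin n → Bool,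
      ((2 ^ n : ℝ))⁻¹ * (∏ i : Fin n, (1 + η * boolSign (x i) * boolSign (y i)) / 2) *
        (boolSign (f x) * boolSign (f y)) := by
  have hone : (1 : ℝ) = ∑ x : Fin n → Bool, ∑ z : Fin n → Bool,
      ((2 ^ n : ℝ))⁻¹ * (∏ i : Fin n, if z i then (1 - η) / 2 else (1 + η) / 2) := by
    simp_rw [← Finset.mul_sum, sum_noise_eq_one]
    simp
  unfold noiseStability
  nth_rewrite 1 [hone]
  rw [Finset.mul_sum, ← Finset.sum_sub_distrib]
  refine Finset.sum_congr rfl fun x _ => ?_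
  rw [Finset.mul_sum, ← Finset.sum_sub_distrib, ← Equiv.sum_comp (xorEquiv x)
    (fun y => ((2 ^ n : ℝ))⁻¹ * (∏ i : Fin n, (1 + η * boolSign (x i) * boolSign (y i)) / 2) *
        (boolSign (f x) * boolSign (f y)))]
  refine Finset.sum_congr rfl fun z _ => ?_
  have hprod : (∏ i : Fin n, if z i then (1 - η) / 2 else (1 + η) / 2) =
      ∏ i : Fin n, (1 + η * boolSign (x i) * boolSign (xorEquiv x z i)) / 2 := by
    refine Finset.prod_congr rfl fun i _ => ?_
    cases hx : x i <;> cases hz : z i <;> simp [xorEquiv, boolSign, hx, hz] <;> ring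
  have hz : (fun i => xor (x i) (z i)) = xorEquiv x z := rfl
  rw [hprod, hz]
  cases f x <;> cases f (xorEquiv x z) <;> simp [boolSign] <;> ring

/-- Noise stability is a polynomial in the correlation with nonnegative coefficients. -/
lemma exists_noiseStability_eq_sum_pow {n : ℕ} (f : (Fin n → Bool) → Bool) :
    ∃ a : Finset (Fin n) → ℝ, (∀ S, 0 ≤ a S) ∧
      ∀ η : ℝ, noiseStability η f = ∑ S, a S * η ^ #S := by
  refine ⟨fun S => (((2 ^ n : ℝ))⁻¹ *
    ∑ x : Fin n → Bool, boolSign (f x) * ∏ i ∈ S, boolSign (x i)) ^ 2, fun S => sq_nonneg _,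
    fun η => ?_⟩
  rw [noiseStability_eq_sum_sign]
  have hexp : ∀ x y : Fin n → Bool,
      ∏ i : Fin n, (1 + η * boolSign (x i) * boolSign (y i)) / 2 =
        ((2 ^ n : ℝ))⁻¹ * ∑ S : Finset (Fin n),
          η ^ #S * (∏ i ∈ S, boolSign (x i)) * ∏ i ∈ S, boolSign (y i) := by
    intro x y
    rw [Finset.prod_div_distrib, Finset.prod_one_add, Finset.powerset_univ]
    simp [Finset.prod_mul_distrib, div_eq_inv_mul]
  simp_rw [hexp]
  have : ∀ S : Finset (Fin n), (((2 ^ n : ℝ))⁻¹ *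
      ∑ x : Fin n → Bool, boolSign (f x) * ∏ i ∈ S, boolSign (x i)) ^ 2 * η ^ #S =
      ∑ x : Fin n → Bool, ∑ y : Fin n → Bool, ((2 ^ n : ℝ))⁻¹ * (((2 ^ n : ℝ))⁻¹ *
        (η ^ #S * (∏ i ∈ S, boolSign (x i)) * ∏ i ∈ S, boolSign (y i))) *
          (boolSign (f x) * boolSign (f y)) := by
    intro S
    rw [mul_pow, sq (∑ x : Fin n → Bool, boolSign (f x) * ∏ i ∈ S, boolSign (x i)),
      Finset.sum_mul_sum, Finset.mul_sum, Finset.sum_mul]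
    refine Finset.sum_congr rfl fun x _ => ?_
    rw [Finset.mul_sum, Finset.sum_mul]
    refine Finset.sum_congr rfl fun y _ => ?_
    ring
  simp_rw [this]
  conv_rhs => rw [Finset.sum_comm]
  refine Finset.sum_congr rfl fun x _ => ?_
  conv_rhs => rw [Finset.sum_comm]
  refine Finset.sum_congr rfl fun y _ => ?_
  rw [Finset.mul_sum, Finset.mul_sum, Finset.sum_mul]

lemma noiseStability_one_le {n : ℕ} (f : (Fin n → Bool) → Bool) : noiseStability 1 f ≤ 1 := by
  unfold noiseStability
  have : 0 ≤ ∑ x : Fin n → Bool, ∑ z : Fin n → Bool,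
      ((2 ^ n : ℝ))⁻¹ * (∏ i : Fin n, if z i then (1 - (1 : ℝ)) / 2 else (1 + 1) / 2) *
        (if f x ≠ f (fun i => xor (x i) (z i)) then 1 else 0) := by
    refine Finset.sum_nonneg fun x _ => Finset.sum_nonneg fun z _ => ?_
    refine mul_nonneg (mul_nonneg (by positivity) (Finset.prod_nonneg fun i _ => ?_)) ?_
    · split_ifs <;> norm_num
    · split_ifs <;> norm_num
  linarith

/-- On `[0, 1]` noise stability is convex in the correlation. -/
lemma noiseStability_le_of_convex {n : ℕ} (f : (Fin n → Bool) → Bool) {δ τ : ℝ}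
    (hδ1 : δ ≤ 1) (hτ : 0 ≤ τ) (hτ1 : τ ≤ 1) :
    noiseStability (1 - τ * δ) f ≤ (1 - τ) + τ * noiseStability (1 - δ) f := by
  obtain ⟨a, ha, h⟩ := exists_noiseStability_eq_sum_pow f
  have h1 := noiseStability_one_le f
  have key : noiseStability (1 - τ * δ) f ≤
      (1 - τ) * noiseStability 1 f + τ * noiseStability (1 - δ) f := by
    rw [h, h, h, Finset.mul_sum, Finset.mul_sum, ← Finset.sum_add_distrib]
    refine Finset.sum_le_sum fun S _ => ?_
    have hc := (convexOn_pow (𝕜 := ℝ) #S).2 (Set.mem_Ici.2 zero_le_one)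
      (Set.mem_Ici.2 (sub_nonneg.2 hδ1)) (sub_nonneg.2 hτ1) hτ (sub_add_cancel 1 τ)
    simp only [smul_eq_mul] at hc
    have e : (1 - τ) * 1 + τ * (1 - δ) = 1 - τ * δ := by ring
    rw [e] at hc
    nlinarith [mul_le_mul_of_nonneg_left hc (ha S)]
  nlinarith [mul_le_mul_of_nonneg_left h1 (by linarith : 0 ≤ 1 - τ)]

end Fourier

section SelfDual

/-- The self-dual function that equals `f` where `i` is on and `j` is off, and the dual of `f`
where `i` is off and `j` is on. -/
def selfDualize {r : ℕ} (i j : Fin r) (f : (Fin r → Bool) → Bool) (x : Fin r → Bool) : Bool :=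
  if x i then (if x j then true else f x)
  else (if x j then !f (fun k => !x k) else false)

lemma selfDualize_monotone {r : ℕ} (i j : Fin r) {f : (Fin r → Bool) → Bool} (hf : Monotone f) :
    Monotone (selfDualize i j f) := by
  intro x y hxy
  have hi := hxy i
  have hj := hxy j
  have h1 := hf hxy
  have h2 : f (fun k => !y k) ≤ f (fun k => !x k) := by
    apply hf
    intro k
    have h := hxy k
    change (!y k) ≤ (!x k)
    exact compl_le_compl h
  unfold selfDualize
  revert hi hj h1 h2
  cases x i <;> cases x j <;> cases y i <;> cases y j <;> cases f x <;> cases f y <;>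
    cases f (fun k => !y k) <;> cases f (fun k => !x k) <;> simp

lemma selfDualize_not {r : ℕ} (i j : Fin r) (f : (Fin r → Bool) → Bool) (x : Fin r → Bool) :
    selfDualize i j f (fun k => !x k) = !selfDualize i j f x := by
  unfold selfDualize
  simp only [Bool.not_not]
  rcases Bool.eq_false_or_eq_true (x i) with hi | hi <;>
    rcases Bool.eq_false_or_eq_true (x j) with hj | hj <;> simp [hi, hj]

lemma selfDualize_of_true_false {r : ℕ} {i j : Fin r} (f : (Fin r → Bool) → Bool)
    {x : Fin r → Bool} (hi : x i = true) (hj : x j = false) : selfDualize i j f x = f x := by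
  simp [selfDualize, hi, hj]

lemma card_true_of_self_dual {r : ℕ} {g : (Fin r → Bool) → Bool}
    (hg : ∀ x, g (fun k => !x k) = !g x) :
    ((Finset.univ.filter (fun x : Fin r → Bool => g x = true)).card : ℝ) / 2 ^ r = 1 / 2 := by
  have hbij : #(univ.filter (fun x : Fin r → Bool => g x = true)) =
      #(univ.filter (fun x : Fin r → Bool => ¬ g x = true)) := by
    refine Finset.card_bij' (fun x _ k => !x k) (fun x _ k => !x k) ?_ ?_ ?_ ?_
    · intro x hx
      simp_all
    · intro x hx
      simp_all
    · intro x _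
      funext k
      simp
    · intro x _
      funext k
      simp
  have hadd := Finset.card_filter_add_card_filter_not (s := (univ : Finset (Fin r → Bool)))
    (fun x => g x = true)
  rw [← hbij] at hadd
  have hcard : #(univ : Finset (Fin r → Bool)) = 2 ^ r := by simp
  rw [hcard] at hadd
  have : (#(univ.filter (fun x : Fin r → Bool => g x = true)) : ℝ) +
      #(univ.filter (fun x : Fin r → Bool => g x = true)) = 2 ^ r := by exact_mod_cast hadd
  have hp : (0 : ℝ) < 2 ^ r := by positivity
  rw [div_eq_iff hp.ne']
  linarith

end SelfDual

section Counting

/-- The monotone formula in disjunctive normal form whose `j`-th clause is the conjunction of the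
variables `F j k`. -/
def dnf {m w r : ℕ} (F : Fin m → Fin w → Fin r) (x : Fin r → Bool) : Bool :=
  decide (∃ j, ∀ k, x (F j k) = true)

lemma dnf_monotone {m w r : ℕ} (F : Fin m → Fin w → Fin r) : Monotone (dnf F) := by
  intro x y hxy
  unfold dnf
  rw [Bool.le_iff_imp]
  simp only [decide_eq_true_eq]
  rintro ⟨j, hj⟩
  exact ⟨j, fun k => Bool.le_iff_imp.1 (hxy _) (hj k)⟩

lemma card_filter_forall_mem {α : Type*} [Fintype α] [DecidableEq α] (k : ℕ) (S : Finset α) :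
    #(univ.filter (fun T : Fin k → α => ∀ l, T l ∈ S)) = #S ^ k := by
  rw [← Fintype.card_piFinset_const]
  congr 1
  ext T
  simp [Fintype.mem_piFinset]

/-- The number of formulas that reject `x` and accept `y`. -/
lemma card_dnf_separating (m w : ℕ) {r : ℕ} (x y : Fin r → Bool) :
    (#(univ.filter (fun F : Fin m → Fin w → Fin r => dnf F x = false ∧ dnf F y = true)) : ℝ) =
      ((r : ℝ) ^ w - (#(univ.filter (fun i => x i = true)) : ℝ) ^ w) ^ m -
      ((r : ℝ) ^ w - (#(univ.filter (fun i => x i = true)) : ℝ) ^ w -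
        ((#(univ.filter (fun i => y i = true)) : ℝ) ^ w -
          (#(univ.filter (fun i => x i = true ∧ y i = true)) : ℝ) ^ w)) ^ m := by
  classical
  let sat (u : Fin r → Bool) (T : Fin w → Fin r) : Prop := ∀ k, u (T k) = true
  have hsat : ∀ u : Fin r → Bool,
      #(univ.filter (fun T => sat u T)) = #(univ.filter (fun i => u i = true)) ^ w := by
    intro u
    rw [← card_filter_forall_mem]
    simp [sat]
  have hboth : #(univ.filter (fun T => sat x T ∧ sat y T)) =
      #(univ.filter (fun i => x i = true ∧ y i = true)) ^ w := by
    rw [← card_filter_forall_mem]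
    simp [sat, forall_and]
  have htot : #(univ : Finset (Fin w → Fin r)) = r ^ w := by simp
  have h1 : (#(univ.filter (fun T => ¬ sat x T)) : ℝ) =
      (r : ℝ) ^ w - (#(univ.filter (fun i => x i = true)) : ℝ) ^ w := by
    have := Finset.card_filter_add_card_filter_not (s := (univ : Finset (Fin w → Fin r)))
      (fun T => sat x T)
    rw [htot, hsat] at this
    have h := congrArg (Nat.cast : ℕ → ℝ) this
    push_cast at h
    linarith
  have h2 : (#(univ.filter (fun T => ¬ sat x T ∧ ¬ sat y T)) : ℝ) =
      (r : ℝ) ^ w - (#(univ.filter (fun i => x i = true)) : ℝ) ^ w -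
        ((#(univ.filter (fun i => y i = true)) : ℝ) ^ w -
          (#(univ.filter (fun i => x i = true ∧ y i = true)) : ℝ) ^ w) := by
    have ha := Finset.card_filter_add_card_filter_not (s := univ.filter (fun T => ¬ sat x T))
      (fun T => sat y T)
    have hb := Finset.card_filter_add_card_filter_not (s := univ.filter (fun T => sat y T))
      (fun T => sat x T)
    simp only [Finset.filter_filter] at ha hb
    have e1 : univ.filter (fun T => sat y T ∧ sat x T) =
      univ.filter (fun T => sat x T ∧ sat y T) := by simp only [and_comm]
    have e2 : univ.filter (fun T => sat y T ∧ ¬ sat x T) =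
      univ.filter (fun T => ¬ sat x T ∧ sat y T) := by simp only [and_comm]
    rw [e1, e2, hboth, hsat] at hb
    have ha' := congrArg (Nat.cast : ℕ → ℝ) ha
    have hb' := congrArg (Nat.cast : ℕ → ℝ) hb
    push_cast at ha' hb'
    linarith
  have hF1 : #(univ.filter (fun F : Fin m → Fin w → Fin r => dnf F x = false)) =
      #(univ.filter (fun T => ¬ sat x T)) ^ m := by
    rw [← card_filter_forall_mem]
    congr 1
    ext F
    simp [dnf, sat]
  have hF2 : #(univ.filter (fun F : Fin m → Fin w → Fin r => dnf F x = false ∧ dnf F y = false)) =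
      #(univ.filter (fun T => ¬ sat x T ∧ ¬ sat y T)) ^ m := by
    rw [← card_filter_forall_mem]
    congr 1
    ext F
    simp [dnf, sat, forall_and]
  have hsplit := Finset.card_filter_add_card_filter_not
    (s := univ.filter (fun F : Fin m → Fin w → Fin r => dnf F x = false))
    (fun F => dnf F y = true)
  simp only [Finset.filter_filter, Bool.not_eq_true] at hsplit
  rw [hF1, hF2] at hsplit
  have h := congrArg (Nat.cast : ℕ → ℝ) hsplit
  push_cast at h
  rw [h1, h2] at h
  linarith

end Counting

section Analysis

open Real

/-- A lower bound for the probability that a random formula separates a typical correlated pair. -/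
noncomputable def gapConst : ℝ :=
  exp (-(2 * exp 4)) * (1 - exp (-(exp (-8) * (1 - exp (-(1 / 20))))))

lemma gapConst_pos : 0 < gapConst := by
  unfold gapConst
  have h1 : exp (-(1 / 20)) < 1 := exp_lt_one_iff.2 (by norm_num)
  have h2 : 0 < exp (-8) * (1 - exp (-(1 / 20))) := mul_pos (exp_pos _) (by linarith)
  have h3 : exp (-(exp (-8) * (1 - exp (-(1 / 20))))) < 1 := exp_lt_one_iff.2 (by linarith)
  exact mul_pos (exp_pos _) (by linarith)

lemma exp_neg_two_mul_le_one_sub {u : ℝ} (h0 : 0 ≤ u) (h1 : u ≤ 1 / 2) :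
    exp (-(2 * u)) ≤ 1 - u := by
  have hpos : 0 < exp (2 * u) := exp_pos _
  rw [exp_neg, inv_le_comm₀ hpos (by linarith)]
  have h2 : 2 * u + 1 ≤ exp (2 * u) := add_one_le_exp _
  refine le_trans ?_ h2
  rw [inv_le_iff_one_le_mul₀ (by linarith)]
  nlinarith

lemma gapConst_le {w : ℕ} {s p P Q : ℝ} (hs : 1000 ≤ s) (hws : (w : ℝ) ≤ s)
    (hsw : s / 2 ≤ w) (hp0 : 0 ≤ p) (hp : p ≤ 1 / 2 * (1 + 4 / s))
    (hP : 1 / 2 * (1 - 4 / s) ≤ P) (hQ0 : 0 ≤ Q)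
    (hQ : Q ≤ P * (1 - 1 / (10 * s))) (hnn : 0 ≤ 1 - p ^ w - (P ^ w - Q ^ w)) :
    gapConst ≤ (1 - p ^ w) ^ (2 ^ w) - (1 - p ^ w - (P ^ w - Q ^ w)) ^ (2 ^ w) := by
  have hs0 : 0 < s := by linarith
  have h4s : 4 / s ≤ 1 / 2 := by rw [div_le_iff₀ hs0]; linarith
  have h4s0 : 0 < 4 / s := by positivity
  have h2w : (0 : ℝ) < 2 ^ w := by positivity
  set a := p ^ w with ha
  set b := P ^ w - Q ^ w with hb
  have ha0 : 0 ≤ a := pow_nonneg hp0 w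
  have hhalf : (1 / 2 : ℝ) ^ w * 2 ^ w = 1 := by rw [← mul_pow]; norm_num
  have ham : a * 2 ^ w ≤ exp 4 := by
    have h1 : a ≤ (1 / 2) ^ w * exp 4 := by
      calc a ≤ (1 / 2 * (1 + 4 / s)) ^ w := pow_le_pow_left₀ hp0 hp w
        _ = (1 / 2) ^ w * (1 + 4 / s) ^ w := mul_pow _ _ _
        _ ≤ (1 / 2) ^ w * exp 4 := by
          gcongr
          calc (1 + 4 / s) ^ w ≤ (exp (4 / s)) ^ w := by
                gcongr
                linarith [add_one_le_exp (4 / s)]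
            _ = exp (w * (4 / s)) := (exp_nat_mul _ _).symm
            _ ≤ exp 4 := by
                gcongr
                rw [mul_div_assoc', div_le_iff₀ hs0]
                linarith
    calc a * 2 ^ w ≤ (1 / 2) ^ w * exp 4 * 2 ^ w := by gcongr
      _ = ((1 / 2) ^ w * 2 ^ w) * exp 4 := by ring
      _ = exp 4 := by rw [hhalf, one_mul]
  have ha2 : a ≤ 1 / 2 := by
    have hw9 : 9 ≤ w := by
      have : (9 : ℝ) ≤ w := by linarith
      exact_mod_cast this
    have h9 : (2 : ℝ) ^ 9 ≤ 2 ^ w := pow_le_pow_right₀ (by norm_num) hw9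
    have he : exp 4 ≤ 81 := by
      have h1 : exp 1 ≤ 3 := by linarith [exp_one_lt_d9]
      calc exp 4 = (exp 1) ^ 4 := by rw [← exp_nat_mul]; norm_num
        _ ≤ 3 ^ 4 := by gcongr
        _ = 81 := by norm_num
    nlinarith
  have hP0 : 0 ≤ P := by linarith
  have hPw : (1 / 2 : ℝ) ^ w * exp (-8) ≤ P ^ w := by
    have hnn' : (0 : ℝ) ≤ 1 - 4 / s := by linarith
    calc (1 / 2 : ℝ) ^ w * exp (-8) ≤ (1 / 2) ^ w * (1 - 4 / s) ^ w := by
          gcongr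
          calc exp (-8) ≤ exp (w * (-(2 * (4 / s)))) := by
                gcongr
                have : (w : ℝ) * (4 / s) ≤ 4 := by
                  rw [mul_div_assoc', div_le_iff₀ hs0]
                  linarith
                linarith
            _ = (exp (-(2 * (4 / s)))) ^ w := exp_nat_mul _ _
            _ ≤ (1 - 4 / s) ^ w := by
                gcongr
                exact exp_neg_two_mul_le_one_sub h4s0.le h4s
      _ = (1 / 2 * (1 - 4 / s)) ^ w := (mul_pow _ _ _).symm
      _ ≤ P ^ w := by gcongr
  have hQw : Q ^ w ≤ P ^ w * exp (-(1 / 20)) := by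
    have h10 : 0 ≤ 1 - 1 / (10 * s) := by
      have : 1 / (10 * s) ≤ 1 := by
        rw [div_le_iff₀ (by positivity)]
        linarith
      linarith
    calc Q ^ w ≤ (P * (1 - 1 / (10 * s))) ^ w := by gcongr
      _ = P ^ w * (1 - 1 / (10 * s)) ^ w := mul_pow _ _ _
      _ ≤ P ^ w * exp (-(1 / 20)) := by
        gcongr
        calc (1 - 1 / (10 * s)) ^ w ≤ (exp (-(1 / (10 * s)))) ^ w := by
              gcongr
              linarith [add_one_le_exp (-(1 / (10 * s)))]
          _ = exp (w * (-(1 / (10 * s)))) := (exp_nat_mul _ _).symm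
          _ ≤ exp (-(1 / 20)) := by
              gcongr
              have : 1 / 20 ≤ (w : ℝ) * (1 / (10 * s)) := by
                rw [mul_one_div, le_div_iff₀ (by positivity)]
                linarith
              linarith
  set κ := exp (-8) * (1 - exp (-(1 / 20))) with hκ
  have he20 : 0 ≤ 1 - exp (-(1 / 20)) := by
    have : exp (-(1 / 20)) < 1 := exp_lt_one_iff.2 (by norm_num)
    linarith
  have hbm : κ ≤ b * 2 ^ w := by
    have h1 : (1 / 2 : ℝ) ^ w * κ ≤ b := by
      calc (1 / 2 : ℝ) ^ w * κ = (1 / 2 : ℝ) ^ w * exp (-8) * (1 - exp (-(1 / 20))) := by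
            rw [hκ]; ring
        _ ≤ P ^ w * (1 - exp (-(1 / 20))) := by gcongr
        _ ≤ b := by rw [hb]; linarith
    calc κ = ((1 / 2 : ℝ) ^ w * 2 ^ w) * κ := by rw [hhalf, one_mul]
      _ = ((1 / 2 : ℝ) ^ w * κ) * 2 ^ w := by ring
      _ ≤ b * 2 ^ w := by gcongr
  have hb0 : 0 ≤ b := by
    have hκ0 : 0 ≤ κ := mul_nonneg (exp_pos _).le he20
    by_contra hneg
    nlinarith
  have hfirst : exp (-(2 * exp 4)) ≤ (1 - a) ^ (2 ^ w) := by
    calc exp (-(2 * exp 4)) ≤ exp ((2 ^ w : ℕ) * (-(2 * a))) := by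
          gcongr
          push_cast
          linarith
      _ = (exp (-(2 * a))) ^ (2 ^ w) := exp_nat_mul _ _
      _ ≤ (1 - a) ^ (2 ^ w) := by
          gcongr
          exact exp_neg_two_mul_le_one_sub ha0 ha2
  have hb1 : 0 ≤ 1 - b := by linarith
  have hsecond : (1 - b) ^ (2 ^ w) ≤ exp (-κ) := by
    calc (1 - b) ^ (2 ^ w) ≤ (exp (-b)) ^ (2 ^ w) := by
          gcongr
          linarith [add_one_le_exp (-b)]
      _ = exp ((2 ^ w : ℕ) * (-b)) := (exp_nat_mul _ _).symm
      _ ≤ exp (-κ) := by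
          gcongr
          push_cast
          linarith
  have hprod : (1 - a - b) ^ (2 ^ w) ≤ (1 - a) ^ (2 ^ w) * (1 - b) ^ (2 ^ w) := by
    rw [← mul_pow]
    gcongr
    nlinarith [mul_nonneg ha0 hb0]
  have h1a : 0 ≤ (1 - a) ^ (2 ^ w) := le_trans (exp_pos _).le hfirst
  have hκ1 : 0 ≤ 1 - exp (-κ) := by
    have hκ0 : 0 ≤ κ := mul_nonneg (exp_pos _).le he20
    have : exp (-κ) ≤ 1 := exp_le_one_iff.2 (by linarith)
    linarith
  calc gapConst = exp (-(2 * exp 4)) * (1 - exp (-κ)) := rfl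
    _ ≤ (1 - a) ^ (2 ^ w) * (1 - exp (-κ)) := by gcongr
    _ ≤ (1 - a) ^ (2 ^ w) * (1 - (1 - b) ^ (2 ^ w)) := by gcongr
    _ ≤ (1 - a) ^ (2 ^ w) - (1 - a - b) ^ (2 ^ w) := by linarith

/-- Every typical pair is separated by a constant fraction of the formulas. -/
lemma gapConst_mul_card_le_card_dnf_separating {r : ℕ} (hr : 1000 ≤ √(r : ℝ))
    {x y : Fin r → Bool}
    (hx : (#(univ.filter (fun i => x i = true)) : ℝ) ≤ r / 2 + 2 * √(r : ℝ))
    (hy : r / 2 - 2 * √(r : ℝ) ≤ (#(univ.filter (fun i => y i = true)) : ℝ))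
    (hxy : √(r : ℝ) / 10 ≤ (#(univ.filter (fun i => ¬ x i = true ∧ y i = true)) : ℝ)) :
    gapConst * Fintype.card (Fin (2 ^ r.sqrt) → Fin r.sqrt → Fin r) ≤
      (#(univ.filter (fun F : Fin (2 ^ r.sqrt) → Fin r.sqrt → Fin r =>
        dnf F x = false ∧ dnf F y = true)) : ℝ) := by
  set s := √(r : ℝ) with hs
  set w := r.sqrt with hw
  have hs0 : 0 < s := by linarith
  have hss : s * s = r := Real.mul_self_sqrt (Nat.cast_nonneg r)
  have hr0 : (0 : ℝ) < r := by rw [← hss]; positivity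
  have hws : (w : ℝ) ≤ s := Real.nat_sqrt_le_real_sqrt
  have hsw : s ≤ w + 1 := Real.real_sqrt_le_nat_sqrt_succ
  rw [card_dnf_separating]
  set A : ℝ := (#(univ.filter (fun i => x i = true)) : ℝ) with hA
  set B : ℝ := (#(univ.filter (fun i => y i = true)) : ℝ) with hB
  set C : ℝ := (#(univ.filter (fun i => x i = true ∧ y i = true)) : ℝ) with hC
  set D : ℝ := (#(univ.filter (fun i => ¬ x i = true ∧ y i = true)) : ℝ) with hD
  have hBCD : C + D = B := by
    have := Finset.card_filter_add_card_filter_not (s := univ.filter (fun i => y i = true))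
      (fun i => x i = true)
    simp only [Finset.filter_filter, and_comm (a := y _ = true)] at this
    rw [hB, hC, hD]
    exact_mod_cast this
  have hBr : B ≤ r := by
    have : #(univ.filter (fun i => y i = true)) ≤ r := by
      simpa using Finset.card_filter_le (univ : Finset (Fin r)) (fun i => y i = true)
    rw [hB]
    exact_mod_cast this
  have hrw : (0 : ℝ) < (r : ℝ) ^ w := by positivity
  have hnn : 0 ≤ 1 - (A / r) ^ w - ((B / r) ^ w - (C / r) ^ w) := by
    have h2 : A ^ w + B ^ w - C ^ w ≤ (r : ℝ) ^ w := by
      classical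
      have hsub : #(univ.filter (fun T : Fin w → Fin r => ∀ k, x (T k) = true) ∪
          univ.filter (fun T : Fin w → Fin r => ∀ k, y (T k) = true)) ≤ r ^ w := by
        refine (Finset.card_le_univ _).trans (by simp)
      have hui := Finset.card_union_add_card_inter
        (univ.filter (fun T : Fin w → Fin r => ∀ k, x (T k) = true))
        (univ.filter (fun T : Fin w → Fin r => ∀ k, y (T k) = true))
      have e : ∀ u : Fin r → Bool, #(univ.filter (fun T : Fin w → Fin r => ∀ k, u (T k) = true)) =
          #(univ.filter (fun i => u i = true)) ^ w := by
        intro u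
        rw [← card_filter_forall_mem]
        simp
      have e' : #(univ.filter (fun T : Fin w → Fin r => ∀ k, x (T k) = true) ∩
          univ.filter (fun T : Fin w → Fin r => ∀ k, y (T k) = true)) =
          #(univ.filter (fun i => x i = true ∧ y i = true)) ^ w := by
        rw [← card_filter_forall_mem, ← Finset.filter_and]
        simp [forall_and]
      rw [e, e, e'] at hui
      have hui' := congrArg (Nat.cast : ℕ → ℝ) hui
      have hsub' := (Nat.cast_le (α := ℝ)).2 hsub
      push_cast at hui' hsub'
      linarith
    have h3 : 1 - (A / r) ^ w - ((B / r) ^ w - (C / r) ^ w) =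
        ((r : ℝ) ^ w - (A ^ w + B ^ w - C ^ w)) / (r : ℝ) ^ w := by
      simp only [div_pow]
      field_simp
      ring
    rw [h3]
    exact div_nonneg (by linarith) hrw.le
  have key := gapConst_le (w := w) (s := s) (p := A / r) (P := B / r) (Q := C / r) hr hws
    (by linarith) (by positivity)
    (by
      rw [div_le_iff₀ hr0]
      have : 1 / 2 * (1 + 4 / s) * r = r / 2 + 2 * s := by
        rw [← hss]; field_simp; ring
      linarith)
    (by
      rw [le_div_iff₀ hr0]
      have : 1 / 2 * (1 - 4 / s) * r = r / 2 - 2 * s := by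
        rw [← hss]; field_simp; ring
      linarith)
    (by positivity)
    (by
      rw [div_mul_eq_mul_div]
      gcongr
      have : B * (1 / (10 * s)) ≤ s / 10 := by
        rw [mul_one_div, div_le_iff₀ (by positivity)]
        nlinarith
      linarith)
    hnn
  have hN : ((Fintype.card (Fin (2 ^ w) → Fin w → Fin r) : ℕ) : ℝ) =
      ((r : ℝ) ^ w) ^ (2 ^ w) := by simp
  rw [hN]
  calc gapConst * ((r : ℝ) ^ w) ^ (2 ^ w) ≤ ((1 - (A / r) ^ w) ^ (2 ^ w) -
        (1 - (A / r) ^ w - ((B / r) ^ w - (C / r) ^ w)) ^ (2 ^ w)) * ((r : ℝ) ^ w) ^ (2 ^ w) := by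
        gcongr
    _ = _ := by
        rw [sub_mul, ← mul_pow, ← mul_pow]
        have hr0' := hr0.ne'
        congr 2
        · simp only [div_pow]
          field_simp
        · simp only [div_pow]
          field_simp

end Analysis

section Probability

open Real

/-- The probability of a given pair of a base point and the set `z` of flipped coordinates. -/
noncomputable def noiseWeight (n : ℕ) (η : ℝ) (z : Fin n → Bool) : ℝ :=
  ((2 ^ n : ℝ))⁻¹ * ∏ i : Fin n, if z i then (1 - η) / 2 else (1 + η) / 2

lemma noiseWeight_nonneg {n : ℕ} {η : ℝ} (h0 : -1 ≤ η) (h1 : η ≤ 1) (z : Fin n → Bool) :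
    0 ≤ noiseWeight n η z := by
  refine mul_nonneg (by positivity) (Finset.prod_nonneg fun i _ => ?_)
  split_ifs <;> linarith

/-- Expectations of products of functions of single coordinates factorize. -/
lemma sum_noiseWeight_mul_prod {n : ℕ} (η : ℝ) (h : Fin n → Bool → Bool → ℝ) :
    ∑ x : Fin n → Bool, ∑ z : Fin n → Bool, noiseWeight n η z * ∏ i, h i (x i) (z i) =
      ∏ i, ((1 + η) / 4 * (h i false false + h i true false) +
        (1 - η) / 4 * (h i false true + h i true true)) := by
  have h1 : ∀ x z : Fin n → Bool, noiseWeight n η z * ∏ i, h i (x i) (z i) =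
      ∏ i, ((1 / 2) * (if z i then (1 - η) / 2 else (1 + η) / 2) * h i (x i) (z i)) := by
    intro x z
    rw [noiseWeight, Finset.prod_mul_distrib, Finset.prod_mul_distrib]
    simp
  have h2 : ∀ x : Fin n → Bool, ∑ z : Fin n → Bool,
      ∏ i, ((1 / 2) * (if z i then (1 - η) / 2 else (1 + η) / 2) * h i (x i) (z i)) =
      ∏ i, ∑ b : Bool, ((1 / 2) * (if b then (1 - η) / 2 else (1 + η) / 2) * h i (x i) b) :=
    fun x => (Fintype.prod_sum (fun i b =>
      (1 / 2) * (if b then (1 - η) / 2 else (1 + η) / 2) * h i (x i) b)).symm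
  simp_rw [h1, h2]
  rw [← Fintype.prod_sum (fun i a =>
    ∑ b : Bool, ((1 / 2) * (if b then (1 - η) / 2 else (1 + η) / 2) * h i a b))]
  refine Finset.prod_congr rfl fun i _ => ?_
  simp only [Fintype.sum_bool, if_true, Bool.false_eq_true, if_false]
  ring

lemma exp_sum_sign {n : ℕ} (l : ℝ) (x : Fin n → Bool) :
    ∏ i, exp (if x i then l else -l) =
      exp (l * (2 * (#(univ.filter (fun i => x i = true)) : ℝ) - n)) := by
  rw [← exp_sum]
  congr 1
  have h : ∀ i, (if x i then l else -l) = 2 * l * (if x i = true then (1 : ℝ) else 0) - l := by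
    intro i
    split_ifs <;> ring
  simp_rw [h]
  rw [Finset.sum_sub_distrib, ← Finset.mul_sum, Finset.sum_boole]
  simp
  ring

lemma exp_sum_indicator {n : ℕ} (p : Fin n → Prop) [DecidablePred p] :
    ∏ i, exp (if p i then -1 else 0) = exp (-(#(univ.filter p) : ℝ)) := by
  rw [← exp_sum]
  congr 1
  have h : ∀ i, (if p i then (-1 : ℝ) else 0) = - (if p i then (1 : ℝ) else 0) := by
    intro i
    split_ifs <;> ring
  simp_rw [h]
  rw [Finset.sum_neg_distrib, Finset.sum_boole]

lemma exp_neg_eight_le : exp (-8) ≤ 1 / 64 := by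
  have h : (2 : ℝ) ^ 8 ≤ exp 8 := by
    calc (2 : ℝ) ^ 8 ≤ (exp 1) ^ 8 := by
          gcongr
          linarith [exp_one_gt_d9]
      _ = exp 8 := by rw [← exp_nat_mul]; norm_num
  rw [exp_neg, inv_le_comm₀ (exp_pos _) (by norm_num)]
  linarith

/-- Chernoff bound for the number of ones of the base point. -/
lemma chernoff_base {r : ℕ} (hr : 1000 ≤ √(r : ℝ)) (η : ℝ) :
    ∑ x : Fin r → Bool, ∑ z : Fin r → Bool, noiseWeight r η z *
      exp (4 / √(r : ℝ) * (2 * (#(univ.filter (fun i => x i = true)) : ℝ) - r) - 16) ≤ 1 / 64 := by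
  set s := √(r : ℝ) with hs
  have hs0 : 0 < s := by linarith
  have hss : s * s = r := Real.mul_self_sqrt (Nat.cast_nonneg r)
  have h := sum_noiseWeight_mul_prod (n := r) η (fun _ a _ => exp (if a then 4 / s else -(4 / s)))
  simp_rw [exp_sum_sign, ← Finset.sum_mul] at h
  simp_rw [sub_eq_add_neg _ (16 : ℝ), exp_add, ← mul_assoc, ← Finset.sum_mul]
  rw [h]
  simp only [if_true, Bool.false_eq_true, if_false]
  have hc : (1 + η) / 4 * (exp (-(4 / s)) + exp (4 / s)) +
      (1 - η) / 4 * (exp (-(4 / s)) + exp (4 / s)) = cosh (4 / s) := by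
    rw [cosh_eq]; ring
  rw [hc, Finset.prod_const, Finset.card_univ, Fintype.card_fin]
  calc cosh (4 / s) ^ r * exp (-16) ≤ exp ((4 / s) ^ 2 / 2) ^ r * exp (-16) := by
        gcongr
        exact cosh_le_exp_half_sq _
    _ = exp (-8) := by
        rw [← exp_nat_mul, ← exp_add, ← hss]
        congr 1
        field_simp
        norm_num
    _ ≤ 1 / 64 := exp_neg_eight_le

/-- Chernoff bound for the number of ones of the noisy copy. -/
lemma chernoff_noisy {r : ℕ} (hr : 1000 ≤ √(r : ℝ)) (η : ℝ) :
    ∑ x : Fin r → Bool, ∑ z : Fin r → Bool, noiseWeight r η z *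
      exp (-(4 / √(r : ℝ)) *
        (2 * (#(univ.filter (fun i => xor (x i) (z i) = true)) : ℝ) - r) - 16) ≤ 1 / 64 := by
  set s := √(r : ℝ) with hs
  have hs0 : 0 < s := by linarith
  have hss : s * s = r := Real.mul_self_sqrt (Nat.cast_nonneg r)
  have h := sum_noiseWeight_mul_prod (n := r) η
    (fun _ a b => exp (if xor a b then -(4 / s) else -(-(4 / s))))
  simp_rw [exp_sum_sign _ (fun i => xor _ _)] at h
  simp_rw [sub_eq_add_neg _ (16 : ℝ), exp_add, ← mul_assoc, ← Finset.sum_mul]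
  rw [h]
  simp only [Bool.xor_false, Bool.xor_true, Bool.not_true, Bool.not_false, if_true,
    Bool.false_eq_true, if_false, neg_neg]
  have hc : (1 + η) / 4 * (exp (4 / s) + exp (-(4 / s))) +
      (1 - η) / 4 * (exp (-(4 / s)) + exp (4 / s)) = cosh (4 / s) := by
    rw [cosh_eq]; ring
  rw [hc, Finset.prod_const, Finset.card_univ, Fintype.card_fin]
  calc cosh (4 / s) ^ r * exp (-16) ≤ exp ((4 / s) ^ 2 / 2) ^ r * exp (-16) := by
        gcongr
        exact cosh_le_exp_half_sq _
    _ = exp (-8) := by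
        rw [← exp_nat_mul, ← exp_add, ← hss]
        congr 1
        field_simp
        norm_num
    _ ≤ 1 / 64 := exp_neg_eight_le

/-- Chernoff bound for the number of coordinates flipped from zero to one. -/
lemma chernoff_flips {r : ℕ} (hr : 1000 ≤ √(r : ℝ)) :
    ∑ x : Fin r → Bool, ∑ z : Fin r → Bool, noiseWeight r (1 - 1 / √(r : ℝ)) z *
      exp (-(#(univ.filter (fun i => ¬ x i = true ∧ xor (x i) (z i) = true)) : ℝ) +
        √(r : ℝ) / 10) ≤ 1 / 64 := by
  set s := √(r : ℝ) with hs
  have hs0 : 0 < s := by linarith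
  have hss : s * s = r := Real.mul_self_sqrt (Nat.cast_nonneg r)
  have h := sum_noiseWeight_mul_prod (n := r) (1 - 1 / s)
    (fun _ a b => exp (if ¬ a = true ∧ xor a b = true then -1 else 0))
  simp_rw [exp_sum_indicator (fun i => ¬ _ = true ∧ xor _ _ = true)] at h
  simp_rw [exp_add, ← mul_assoc, ← Finset.sum_mul]
  rw [h]
  simp only [Bool.xor_false, Bool.xor_true, Bool.not_true, Bool.not_false, if_true,
    Bool.false_eq_true, if_false, not_true, not_false_eq_true, and_false, and_true,
    exp_zero]
  have he : exp (-1) ≤ 2 / 5 := by linarith [exp_neg_one_lt_d9]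
  have hc : (1 + (1 - 1 / s)) / 4 * (1 + 1) + (1 - (1 - 1 / s)) / 4 * (exp (-1) + 1) ≤
      exp (-(3 / 20 * (1 / s))) := by
    have h1 := add_one_le_exp (-(3 / 20 * (1 / s)))
    have h2 : 0 < 1 / s := by positivity
    nlinarith
  have hnn : 0 ≤ (1 + (1 - 1 / s)) / 4 * (1 + 1) + (1 - (1 - 1 / s)) / 4 * (exp (-1) + 1) := by
    have h2 : 0 < 1 / s := by positivity
    have h3 : 1 / s ≤ 1 := by rw [div_le_iff₀ hs0]; linarith
    have h4 := exp_pos (-1)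
    nlinarith [mul_pos h2 h4]
  rw [Finset.prod_const, Finset.card_univ, Fintype.card_fin]
  calc _ ≤ exp (-(3 / 20 * (1 / s))) ^ r * exp (s / 10) := by gcongr
    _ = exp (-(s / 20)) := by
        rw [← exp_nat_mul, ← exp_add, ← hss]
        congr 1
        field_simp
        norm_num
    _ ≤ exp (-8) := by
        gcongr
        linarith
    _ ≤ 1 / 64 := exp_neg_eight_le

/-- The probability that two given coordinates are `1` and `0` both before and after the noise. -/
lemma sum_noiseWeight_fixed {n : ℕ} {η : ℝ} (hη : 1 / 2 ≤ η) {i j : Fin n} (hij : i ≠ j) :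
    9 / 64 ≤ ∑ x : Fin n → Bool, ∑ z : Fin n → Bool, noiseWeight n η z *
      (if x i = true ∧ x j = false ∧ z i = false ∧ z j = false then 1 else 0) := by
  have h := sum_noiseWeight_mul_prod (n := n) η (fun k a b =>
    (if k = i then (if a = true ∧ b = false then 1 else 0) else 1) *
      (if k = j then (if a = false ∧ b = false then 1 else 0) else 1))
  have hprod : ∀ x z : Fin n → Bool,
      ∏ k, ((if k = i then (if x k = true ∧ z k = false then (1 : ℝ) else 0) else 1) *
        (if k = j then (if x k = false ∧ z k = false then 1 else 0) else 1)) =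
      if x i = true ∧ x j = false ∧ z i = false ∧ z j = false then 1 else 0 := by
    intro x z
    rw [Finset.prod_mul_distrib, Finset.prod_ite_eq', Finset.prod_ite_eq']
    simp only [mem_univ, if_true]
    split_ifs <;> simp_all
  simp_rw [hprod] at h
  rw [h]
  calc (9 / 64 : ℝ) ≤ (1 + η) / 4 * ((1 + η) / 4) := by nlinarith
    _ = ∏ k : Fin n, (if k = i then (1 + η) / 4 else 1) * (if k = j then (1 + η) / 4 else 1) := by
      rw [Finset.prod_mul_distrib, Finset.prod_ite_eq', Finset.prod_ite_eq']
      simp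
    _ = _ := by
      refine Finset.prod_congr rfl fun k _ => ?_
      by_cases hi : k = i
      · have hj : k ≠ j := hi ▸ hij
        simp [hi, hij]
      · by_cases hj : k = j
        · simp [hj, hij.symm]
        · simp [hi, hj]
          ring

/-- The pair given by a base point `x` and flips `z` is typical and its coordinates `i` and `j`
are `1` and `0` both before and after the noise. -/
def IsTypical {r : ℕ} (i j : Fin r) (x z : Fin r → Bool) : Prop :=
  (x i = true ∧ x j = false ∧ z i = false ∧ z j = false) ∧
  (#(univ.filter (fun k => x k = true)) : ℝ) ≤ r / 2 + 2 * √(r : ℝ) ∧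
  r / 2 - 2 * √(r : ℝ) ≤ (#(univ.filter (fun k => xor (x k) (z k) = true)) : ℝ) ∧
  √(r : ℝ) / 10 ≤ (#(univ.filter (fun k => ¬ x k = true ∧ xor (x k) (z k) = true)) : ℝ)

open Classical in
lemma sum_noiseWeight_isTypical {r : ℕ} (hr : 1000 ≤ √(r : ℝ)) {i j : Fin r} (hij : i ≠ j) :
    1 / 16 ≤ ∑ x : Fin r → Bool, ∑ z : Fin r → Bool, noiseWeight r (1 - 1 / √(r : ℝ)) z *
      (if IsTypical i j x z then 1 else 0) := by
  have h1 := chernoff_base hr (1 - 1 / √(r : ℝ))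
  have h2 := chernoff_noisy hr (1 - 1 / √(r : ℝ))
  have h3 := chernoff_flips hr
  have hs0 : 0 < √(r : ℝ) := by linarith
  have hs1 : 1 / √(r : ℝ) ≤ 1 / 2 := by rw [div_le_iff₀ hs0]; linarith
  have hs2 : 0 < 1 / √(r : ℝ) := by positivity
  have h4 := sum_noiseWeight_fixed (η := 1 - 1 / √(r : ℝ)) (by linarith) hij
  set s := √(r : ℝ) with hs
  have hle : ∑ x : Fin r → Bool, ∑ z : Fin r → Bool, noiseWeight r (1 - 1 / s) z *
      (if x i = true ∧ x j = false ∧ z i = false ∧ z j = false then 1 else 0) ≤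
      ∑ x : Fin r → Bool, ∑ z : Fin r → Bool, (noiseWeight r (1 - 1 / s) z *
        (if IsTypical i j x z then 1 else 0) +
      noiseWeight r (1 - 1 / s) z *
        exp (4 / s * (2 * (#(univ.filter (fun i => x i = true)) : ℝ) - r) - 16) +
      noiseWeight r (1 - 1 / s) z * exp (-(4 / s) *
        (2 * (#(univ.filter (fun i => xor (x i) (z i) = true)) : ℝ) - r) - 16) +
      noiseWeight r (1 - 1 / s) z *
        exp (-(#(univ.filter (fun i => ¬ x i = true ∧ xor (x i) (z i) = true)) : ℝ) +
          s / 10)) := by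
    refine Finset.sum_le_sum fun x _ => Finset.sum_le_sum fun z _ => ?_
    rw [← mul_add, ← mul_add, ← mul_add]
    refine mul_le_mul_of_nonneg_left ?_ (noiseWeight_nonneg (by linarith) (by linarith) z)
    have e1 := exp_pos (4 / s * (2 * (#(univ.filter (fun i => x i = true)) : ℝ) - r) - 16)
    have e2 := exp_pos (-(4 / s) *
      (2 * (#(univ.filter (fun i => xor (x i) (z i) = true)) : ℝ) - r) - 16)
    have e3 := exp_pos
      (-(#(univ.filter (fun i => ¬ x i = true ∧ xor (x i) (z i) = true)) : ℝ) + s / 10)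
    have e0 : (0 : ℝ) ≤ if IsTypical i j x z then 1 else 0 := by split_ifs <;> norm_num
    have h4s : 4 / s * (4 * s) = 16 := by field_simp; norm_num
    have h4s0 : 0 < 4 / s := by positivity
    split_ifs with hz ht
    · linarith
    · by_cases c1 : (#(univ.filter (fun k => x k = true)) : ℝ) ≤ r / 2 + 2 * s
      · by_cases c2 : r / 2 - 2 * s ≤ (#(univ.filter (fun k => xor (x k) (z k) = true)) : ℝ)
        · have c3 : (#(univ.filter (fun k => ¬ x k = true ∧ xor (x k) (z k) = true)) : ℝ) <
              s / 10 := by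
            by_contra hc
            exact ht ⟨hz, c1, c2, not_lt.1 hc⟩
          have := one_le_exp (x := -(#(univ.filter (fun i => ¬ x i = true ∧
            xor (x i) (z i) = true)) : ℝ) + s / 10) (by linarith)
          linarith
        · have := one_le_exp (x := -(4 / s) *
            (2 * (#(univ.filter (fun i => xor (x i) (z i) = true)) : ℝ) - r) - 16) (by
              have := mul_le_mul_of_nonneg_left (show 4 * s ≤ -(2 * (#(univ.filter
                (fun i => xor (x i) (z i) = true)) : ℝ) - r) by linarith) h4s0.le
              linarith)
          linarith
      · have := one_le_exp (x := 4 / s *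
          (2 * (#(univ.filter (fun i => x i = true)) : ℝ) - r) - 16) (by
            have := mul_le_mul_of_nonneg_left (show 4 * s ≤ (2 * (#(univ.filter
              (fun i => x i = true)) : ℝ) - r) by linarith) h4s0.le
            linarith)
        linarith
    · linarith
    · linarith
  simp only [Finset.sum_add_distrib] at hle
  linarith

/-- Some formula separates a constant fraction of the correlated pairs whose coordinates `i` and
`j` are `1` and `0` both before and after the noise. -/
lemma exists_dnf_separating {r : ℕ} (hr : 1000 ≤ √(r : ℝ)) {i j : Fin r} (hij : i ≠ j) :
    ∃ F : Fin (2 ^ r.sqrt) → Fin r.sqrt → Fin r,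
      gapConst / 16 ≤ ∑ x : Fin r → Bool, ∑ z : Fin r → Bool,
        noiseWeight r (1 - 1 / √(r : ℝ)) z *
          (if (x i = true ∧ x j = false ∧ z i = false ∧ z j = false) ∧
            dnf F x = false ∧ dnf F (fun k => xor (x k) (z k)) = true then 1 else 0) := by
  classical
  have hs0 : 0 < √(r : ℝ) := by linarith
  have hs1 : 1 / √(r : ℝ) ≤ 1 := by rw [div_le_iff₀ hs0]; linarith
  have hs2 : 0 < 1 / √(r : ℝ) := by positivity
  have : Nonempty (Fin r) := ⟨i⟩
  obtain ⟨F, -, hF⟩ := Finset.exists_le_of_sum_le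
    (s := (univ : Finset (Fin (2 ^ r.sqrt) → Fin r.sqrt → Fin r)))
    (f := fun _ => gapConst / 16)
    (g := fun F => ∑ x : Fin r → Bool, ∑ z : Fin r → Bool,
        noiseWeight r (1 - 1 / √(r : ℝ)) z *
          (if (x i = true ∧ x j = false ∧ z i = false ∧ z j = false) ∧
            dnf F x = false ∧ dnf F (fun k => xor (x k) (z k)) = true then 1 else 0))
    univ_nonempty (by
      rw [Finset.sum_const, nsmul_eq_mul, Finset.sum_comm, Finset.card_univ]
      calc _ = 1 / 16 *
            (gapConst * Fintype.card (Fin (2 ^ r.sqrt) → Fin r.sqrt → Fin r)) := by ring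
        _ ≤ (∑ x : Fin r → Bool, ∑ z : Fin r → Bool, noiseWeight r (1 - 1 / √(r : ℝ)) z *
              (if IsTypical i j x z then 1 else 0)) *
            (gapConst * Fintype.card (Fin (2 ^ r.sqrt) → Fin r.sqrt → Fin r)) :=
          mul_le_mul_of_nonneg_right (sum_noiseWeight_isTypical hr hij)
            (mul_nonneg gapConst_pos.le (Nat.cast_nonneg _))
        _ ≤ _ := by
          rw [Finset.sum_mul]
          refine Finset.sum_le_sum fun x _ => ?_
          rw [Finset.sum_mul, Finset.sum_comm]
          refine Finset.sum_le_sum fun z _ => ?_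
          rw [← Finset.mul_sum, mul_assoc]
          refine mul_le_mul_of_nonneg_left ?_ (noiseWeight_nonneg (by linarith) (by linarith) z)
          split_ifs with ht
          · rw [one_mul]
            refine (gapConst_mul_card_le_card_dnf_separating hr ht.2.1 ht.2.2.1 ht.2.2.2).trans
              (le_of_eq ?_)
            rw [← Finset.sum_boole]
            refine Finset.sum_congr rfl fun F _ => ?_
            simp only [ht.1, true_and, and_self]
          · rw [zero_mul]
            refine Finset.sum_nonneg fun F _ => ?_
            split_ifs <;> norm_num)
  exact ⟨F, hF⟩

end Probability

/-- The self-dualization of a well-chosen formula has constant noise sensitivity at noise rate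
`1 / √r`. -/
lemma exists_noiseStability_le {r : ℕ} (hr : 1000 ≤ √(r : ℝ)) :
    ∃ g : (Fin r → Bool) → Bool, Monotone g ∧ (∀ x, g (fun k => !x k) = !g x) ∧
      noiseStability (1 - 1 / √(r : ℝ)) g ≤ 1 - gapConst / 8 := by
  have hs0 : 0 < √(r : ℝ) := by linarith
  have hs1 : 1 / √(r : ℝ) ≤ 1 := by rw [div_le_iff₀ hs0]; linarith
  have hs2 : 0 < 1 / √(r : ℝ) := by positivity
  have hr2 : 2 ≤ r := by
    by_contra hlt
    have h1 : (r : ℝ) ≤ 1 := by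
      have : r ≤ 1 := by omega
      exact_mod_cast this
    have := Real.sqrt_le_one.2 h1
    linarith
  have hij : (⟨0, by omega⟩ : Fin r) ≠ ⟨1, by omega⟩ := by simp
  obtain ⟨F, hF⟩ := exists_dnf_separating hr hij
  refine ⟨selfDualize ⟨0, by omega⟩ ⟨1, by omega⟩ (dnf F),
    selfDualize_monotone _ _ (dnf_monotone F), selfDualize_not _ _ _, ?_⟩
  unfold noiseStability
  have hsep : ∀ x z : Fin r → Bool,
      (if (x ⟨0, by omega⟩ = true ∧ x ⟨1, by omega⟩ = false ∧ z ⟨0, by omega⟩ = false ∧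
          z ⟨1, by omega⟩ = false) ∧ dnf F x = false ∧ dnf F (fun k => xor (x k) (z k)) = true
        then (1 : ℝ) else 0) ≤
      if selfDualize ⟨0, by omega⟩ ⟨1, by omega⟩ (dnf F) x ≠
        selfDualize ⟨0, by omega⟩ ⟨1, by omega⟩ (dnf F) (fun k => xor (x k) (z k)) then 1 else 0 := by
    intro x z
    by_cases h : (x ⟨0, by omega⟩ = true ∧ x ⟨1, by omega⟩ = false ∧ z ⟨0, by omega⟩ = false ∧
        z ⟨1, by omega⟩ = false) ∧ dnf F x = false ∧ dnf F (fun k => xor (x k) (z k)) = true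
    · rw [if_pos h]
      obtain ⟨⟨hxi, hxj, hzi, hzj⟩, hx, hy⟩ := h
      rw [selfDualize_of_true_false _ hxi hxj,
        selfDualize_of_true_false _ (by simp [hxi, hzi]) (by simp [hxj, hzj]), hx, hy]
      simp
    · rw [if_neg h]
      positivity
  have hle := hF.trans (Finset.sum_le_sum fun x _ => Finset.sum_le_sum fun z _ =>
    mul_le_mul_of_nonneg_left (hsep x z)
      (noiseWeight_nonneg (η := 1 - 1 / √(r : ℝ)) (by linarith) (by linarith) z))
  unfold noiseWeight at hle
  linarith

/-- Mossel–O'Donnell: there are `K > 0` and `R` such that for every `r ≥ R` there is a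
balanced monotone `g_r : {0,1}^r → {0,1}` with `NS_{1-τ/√r}(g_r) ≤ 1 - Kτ` for every
`τ ∈ [16/√r, 1]`. -/
theorem stmt16 :
    ∃ (K : ℝ) (R : ℕ), 0 < K ∧ ∀ r : ℕ, R ≤ r →
      ∃ g : (Fin r → Bool) → Bool, Monotone g ∧
        ((Finset.univ.filter (fun x : Fin r → Bool => g x = true)).card : ℝ) / 2 ^ r = 1 / 2 ∧
        ∀ τ : ℝ, 16 / Real.sqrt r ≤ τ → τ ≤ 1 →
          noiseStability (1 - τ / Real.sqrt r) g ≤ 1 - K * τ := by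
  refine ⟨gapConst / 8, 1000 ^ 2, div_pos gapConst_pos (by norm_num), fun r hr => ?_⟩
  have hs : 1000 ≤ √(r : ℝ) := by
    apply Real.le_sqrt_of_sq_le
    exact_mod_cast hr
  have hs0 : 0 < √(r : ℝ) := by linarith
  obtain ⟨g, hmono, hdual, hns⟩ := exists_noiseStability_le hs
  refine ⟨g, hmono, card_true_of_self_dual hdual, fun τ hτ0 hτ1 => ?_⟩
  have hτ : 0 ≤ τ := le_trans (by positivity) hτ0
  have h := noiseStability_le_of_convex g (δ := 1 / √(r : ℝ))
    (by rw [div_le_iff₀ hs0]; linarith) hτ hτ1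
  rw [mul_one_div] at h
  nlinarith [mul_le_mul_of_nonneg_left hns hτ]
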